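/- Let 1/2 < β < 1, let ψ_β(x₁,x₂) = (1/8)·(x₁ − 2β)·(1 − x₁² − x₂²), and let Ω_β⁺ := {(x₁,x₂) ∈ ℝ² : x₁² + x₂² < 1 and x₁ < β}. Suppose ψ̂ ∈ C⁰(closure(Ω_β⁺)) ∩ C²(Ω_β⁺) satisfies Δψ̂ = β − x₁ in Ω_β⁺ and ψ̂ = 0 on ∂Ω_β⁺. Then ψ_β(x) < ψ̂(x) for every x ∈ Ω_β⁺, and consequently the oscillation of ψ̂ over Ω_β⁺ is strictly smaller than the oscillation of ψ_β over the unit disc D(0,1): sup_{Ω_β⁺} ψ̂ − inf_{Ω_β⁺} ψ̂ < sup_{D(0,1)} ψ_β − inf_{D(0,1)} ψ_β. -/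

import Mathlib

open MeasureTheory Set Filter Topology

noncomputable section

/-- First partial derivative (in the direction `x₁`) of a function on `ℝ × ℝ`. -/
def pd1 {E : Type*} [NormedAddCommGroup E] [NormedSpace ℝ E] (u : ℝ × ℝ → E) (x : ℝ × ℝ) : E :=
  fderiv ℝ u x (1, 0)

/-- Second partial derivative (in the direction `x₂`) of a function on `ℝ × ℝ`. -/
def pd2 {E : Type*} [NormedAddCommGroup E] [NormedSpace ℝ E] (u : ℝ × ℝ → E) (x : ℝ × ℝ) : E :=
  fderiv ℝ u x (0, 1)

/-- The Laplacian on `ℝ × ℝ`. -/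
def lap (ψ : ℝ × ℝ → ℝ) (x : ℝ × ℝ) : ℝ := pd1 (pd1 ψ) x + pd2 (pd2 ψ) x

/-- Test functions for the Dirichlet variational problems on `Ω`:
nonzero smooth compactly supported functions with support in `Ω`. -/
def IsTestFun (Ω : Set (ℝ × ℝ)) (u : ℝ × ℝ → ℂ) : Prop :=
  ContDiff ℝ (⊤ : ℕ∞) u ∧ HasCompactSupport u ∧ tsupport u ⊆ Ω ∧ u ≠ 0

/-- Rayleigh quotient of the spin-`σ` (`σ = -1` : spin-down, `σ = 1` : spin-up)
Dirichlet Pauli operator at the test function `u`. -/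
def pauliRayleigh (σ : ℝ) (h : ℝ) (A : ℝ × ℝ → ℝ × ℝ) (B : ℝ × ℝ → ℝ) (Ω : Set (ℝ × ℝ))
    (u : ℝ × ℝ → ℂ) : ℝ :=
  ((∫ x in Ω, (‖(h : ℂ) * pd1 u x - Complex.I * ((A x).1 : ℂ) * u x‖ ^ 2
      + ‖(h : ℂ) * pd2 u x - Complex.I * ((A x).2 : ℂ) * u x‖ ^ 2))
    + σ * (h * ∫ x in Ω, B x * ‖u x‖ ^ 2)) / ∫ x in Ω, ‖u x‖ ^ 2

/-- The ground state energy `λ₋^D(h,A,B,Ω)` of the spin-down Dirichlet Pauli operator. -/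
def lambdaMinusD (h : ℝ) (A : ℝ × ℝ → ℝ × ℝ) (B : ℝ × ℝ → ℝ) (Ω : Set (ℝ × ℝ)) : ℝ :=
  sInf (pauliRayleigh (-1) h A B Ω '' {u | IsTestFun Ω u})

/-- The ground state energy `λ₊^D(h,A,B,Ω)` of the spin-up Dirichlet Pauli operator. -/
def lambdaPlusD (h : ℝ) (A : ℝ × ℝ → ℝ × ℝ) (B : ℝ × ℝ → ℝ) (Ω : Set (ℝ × ℝ)) : ℝ :=
  sInf (pauliRayleigh 1 h A B Ω '' {u | IsTestFun Ω u})

/-- The ground state energy `Λ^D(h,A,B,Ω)` of the full Dirichlet Pauli operator. -/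
def LambdaD (h : ℝ) (A : ℝ × ℝ → ℝ × ℝ) (B : ℝ × ℝ → ℝ) (Ω : Set (ℝ × ℝ)) : ℝ :=
  min (lambdaMinusD h A B Ω) (lambdaPlusD h A B Ω)

/-- The canonical vector potential `∇⊥ψ = (−∂₂ψ, ∂₁ψ)`. -/
def perpGrad (ψ : ℝ × ℝ → ℝ) (x : ℝ × ℝ) : ℝ × ℝ := (-(pd2 ψ x), pd1 ψ x)

/-- `ψ` is the scalar potential of `B` on `Ω`: `ψ ∈ C⁰(closure Ω) ∩ C²(Ω)`,
`Δψ = B` in `Ω` and `ψ = 0` on `∂Ω`. -/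
structure IsScalarPotential (Ω : Set (ℝ × ℝ)) (B : ℝ × ℝ → ℝ) (ψ : ℝ × ℝ → ℝ) : Prop where
  contOn : ContinuousOn ψ (closure Ω)
  c2 : ContDiffOn ℝ 2 ψ Ω
  lap_eq : ∀ x ∈ Ω, lap ψ x = B x
  bdry : ∀ x ∈ frontier Ω, ψ x = 0

/-- `A` is a continuous vector potential for `B` on `Ω`: `∂₁A₂ − ∂₂A₁ = B`. -/
def IsVectorPotential (Ω : Set (ℝ × ℝ)) (B : ℝ × ℝ → ℝ) (A : ℝ × ℝ → ℝ × ℝ) : Prop :=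
  ContinuousOn A Ω ∧ ∀ x ∈ Ω, pd1 (fun y => (A y).2) x - pd2 (fun y => (A y).1) x = B x

/-- `γ` is a regular curve of class `C^{2,α}` on the parameter set `s`. -/
def C2HolderOn (α : ℝ) (γ : ℝ → ℝ × ℝ) (s : Set ℝ) : Prop :=
  ContDiffOn ℝ 2 γ s ∧
  (∃ C : ℝ, ∀ x ∈ s, ∀ y ∈ s,
      ‖derivWithin (derivWithin γ s) s x - derivWithin (derivWithin γ s) s y‖ ≤ C * |x - y| ^ α) ∧
  ∀ x ∈ s, derivWithin γ s x ≠ 0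

/-- Near `p`, the set `Γ` is a regular curve of class `C^{2,α}`. -/
def IsLocallyC2CurveAt (α : ℝ) (Γ : Set (ℝ × ℝ)) (p : ℝ × ℝ) : Prop :=
  ∃ ε > 0, ∃ γ : ℝ → ℝ × ℝ, C2HolderOn α γ (Icc (-1) 1) ∧ γ 0 = p ∧
    Γ ∩ Metric.ball p ε = γ '' Ioo (-1) 1 ∩ Metric.ball p ε

/-- `Γ` is (locally) a regular curve of class `C^{2,α}`. -/
def IsC2HolderSet (α : ℝ) (Γ : Set (ℝ × ℝ)) : Prop := ∀ p ∈ Γ, IsLocallyC2CurveAt α Γ p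

/-- `Ω` has a corner at `p` formed by two `C^{2,α}` arcs, of aperture less than `π`
(near `p`, `Ω` is contained in a strictly convex open cone with vertex `p`). -/
def HasConvexCornerAt (Ω : Set (ℝ × ℝ)) (α : ℝ) (p : ℝ × ℝ) : Prop :=
  ∃ ε > 0, (∃ γ₁ γ₂ : ℝ → ℝ × ℝ, C2HolderOn α γ₁ (Icc 0 1) ∧ C2HolderOn α γ₂ (Icc 0 1) ∧
      γ₁ 0 = p ∧ γ₂ 0 = p ∧
      frontier Ω ∩ Metric.ball p ε = (γ₁ '' Ico 0 1 ∪ γ₂ '' Ico 0 1) ∩ Metric.ball p ε) ∧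
    ∃ w : ℝ × ℝ, ∃ c > 0, ∀ x ∈ Ω ∩ Metric.ball p ε,
      c * ‖x - p‖ ≤ (x - p).1 * w.1 + (x - p).2 * w.2

/-- `Ω` has a continuous boundary which is piecewise of class `C^{2,α}` for some `α > 0`,
with at most finitely many corners, each of aperture less than `π`. -/
def HasPiecewiseC2Boundary (Ω : Set (ℝ × ℝ)) : Prop :=
  ∃ α > 0, ∃ S : Finset (ℝ × ℝ), ↑S ⊆ frontier Ω ∧
    (∀ p ∈ frontier Ω \ (S : Set (ℝ × ℝ)), IsLocallyC2CurveAt α (frontier Ω) p) ∧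
    ∀ p ∈ S, HasConvexCornerAt Ω α p

/-- Assumption (R): `Ω` is bounded and open with continuous, piecewise `C^{2,α}` boundary
having finitely many corners of aperture `< π`, and `B` extends continuously to `closure Ω`. -/
structure AssumptionR (Ω : Set (ℝ × ℝ)) (B : ℝ × ℝ → ℝ) : Prop where
  isOpen : IsOpen Ω
  bounded : Bornology.IsBounded Ω
  bdryReg : HasPiecewiseC2Boundary Ω
  fieldCont : ContinuousOn B (closure Ω)

/-- The oscillation of `ψ` over `Ω`. -/
def osc (ψ : ℝ × ℝ → ℝ) (Ω : Set (ℝ × ℝ)) : ℝ := sSup (ψ '' Ω) - sInf (ψ '' Ω)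

/-- The region enclosed by `Γ`: the union of the bounded connected components of `Γᶜ`. -/
def curveInterior (Γ : Set (ℝ × ℝ)) : Set (ℝ × ℝ) :=
  {x | x ∉ Γ ∧ Bornology.IsBounded (connectedComponentIn Γᶜ x)}

/-- `Γ` is a simple closed curve of class `C^{2,α}`. -/
def IsC2ClosedCurve (α : ℝ) (Γ : Set (ℝ × ℝ)) : Prop :=
  ∃ γ : ℝ → ℝ × ℝ, Function.Periodic γ 1 ∧ C2HolderOn α γ (Icc 0 1) ∧
    InjOn γ (Ico 0 1) ∧ Γ = γ '' Icc 0 1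

/-- The ground state energy `λ^D(Ω)` of the Dirichlet Laplacian on `Ω`. -/
def dirichletGSE (Ω : Set (ℝ × ℝ)) : ℝ :=
  sInf ((fun u : ℝ × ℝ → ℝ =>
      (∫ x in Ω, (pd1 u x ^ 2 + pd2 u x ^ 2)) / ∫ x in Ω, u x ^ 2) ''
    {u | ContDiff ℝ (⊤ : ℕ∞) u ∧ HasCompactSupport u ∧ tsupport u ⊆ Ω ∧ u ≠ 0})

/-- The open disc of radius `R` centred at the origin (with the Euclidean distance). -/
def disc (R : ℝ) : Set (ℝ × ℝ) := {y : ℝ × ℝ | y.1 ^ 2 + y.2 ^ 2 < R ^ 2}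

end

/-- Second derivative test, necessary direction, on the line. -/
theorem IsLocalMin.deriv_deriv_nonneg {g : ℝ → ℝ} {x : ℝ} (hg : IsLocalMin g x)
    (hc : ContinuousAt g x) : 0 ≤ deriv (deriv g) x := by
  by_contra! hneg
  have hmax : IsLocalMax g x := isLocalMax_of_deriv_deriv_neg hneg hg.deriv_eq_zero hc
  have hconst : g =ᶠ[𝓝 x] fun _ => g x := by
    filter_upwards [hg, hmax] with y h₁ h₂ using le_antisymm h₂ h₁
  have hzero : deriv (deriv g) x = 0 := by
    rw [hconst.deriv.deriv_eq]
    simp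
  exact hneg.ne hzero

section DirectionalDerivatives

variable {E : Type*} [NormedAddCommGroup E] [NormedSpace ℝ E]

theorem ContDiffAt.differentiableAt_fderiv_apply {f : E → ℝ} {x : E} (hf : ContDiffAt ℝ 2 f x)
    (v : E) : DifferentiableAt ℝ (fun y => fderiv ℝ f y v) x :=
  ((hf.fderiv_right (m := 1) (by norm_num)).differentiableAt (by norm_num)).clm_apply
    (differentiableAt_const v)

theorem ContDiffAt.eventually_differentiableAt {f : E → ℝ} {x : E} (hf : ContDiffAt ℝ 2 f x) :
    ∀ᶠ y in 𝓝 x, DifferentiableAt ℝ f y :=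
  (hf.eventually (by simp)).mono fun _ hy => hy.differentiableAt (by norm_num)

theorem HasFDerivAt.hasDerivAt_line {f : E → ℝ} {x v : E} {t : ℝ} {f' : E →L[ℝ] ℝ}
    (hf : HasFDerivAt f f' (x + t • v)) : HasDerivAt (fun s : ℝ => f (x + s • v)) (f' v) t := by
  have hl : HasDerivAt (fun s : ℝ => x + s • v) v t := by
    simpa using ((hasDerivAt_id t).smul_const v).const_add x
  exact hf.comp_hasDerivAt t hl

/-- At a local minimum, every pure second directional derivative is nonnegative. -/
theorem IsLocalMin.fderiv_fderiv_apply_nonneg {f : E → ℝ} {x : E} (hmin : IsLocalMin f x)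
    (hf : ContDiffAt ℝ 2 f x) (v : E) : 0 ≤ fderiv ℝ (fun y => fderiv ℝ f y v) x v := by
  have hl : Continuous fun t : ℝ => x + t • v := by fun_prop
  have hl0 : Tendsto (fun t : ℝ => x + t • v) (𝓝 0) (𝓝 x) := by
    simpa using hl.tendsto 0
  have hderiv : deriv (fun t : ℝ => f (x + t • v)) =ᶠ[𝓝 0]
      fun t => fderiv ℝ f (x + t • v) v := by
    filter_upwards [hl0.eventually hf.eventually_differentiableAt] with t ht
    exact ht.hasFDerivAt.hasDerivAt_line.deriv
  have hsecond : deriv (deriv fun t : ℝ => f (x + t • v)) 0 =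
      fderiv ℝ (fun y => fderiv ℝ f y v) x v := by
    rw [hderiv.deriv_eq]
    refine HasDerivAt.deriv
      (HasFDerivAt.hasDerivAt_line (f := fun y => fderiv ℝ f y v) ?_)
    simpa using (hf.differentiableAt_fderiv_apply v).hasFDerivAt
  rw [← hsecond]
  refine IsLocalMin.deriv_deriv_nonneg ?_ ?_
  · have h := hl0.eventually hmin
    simpa [IsLocalMin, IsMinFilter] using h
  · refine ContinuousAt.comp (f := fun t : ℝ => x + t • v) ?_ hl.continuousAt
    simpa using hf.continuousAt

theorem fderiv_fderiv_apply_sub {f g : E → ℝ} {x : E} (hf : ContDiffAt ℝ 2 f x)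
    (hg : ContDiffAt ℝ 2 g x) (v : E) :
    fderiv ℝ (fun y => fderiv ℝ (fun z => f z - g z) y v) x v =
      fderiv ℝ (fun y => fderiv ℝ f y v) x v - fderiv ℝ (fun y => fderiv ℝ g y v) x v := by
  have h : (fun y => fderiv ℝ (fun z => f z - g z) y v) =ᶠ[𝓝 x]
      fun y => fderiv ℝ f y v - fderiv ℝ g y v := by
    filter_upwards [hf.eventually_differentiableAt, hg.eventually_differentiableAt] with y h₁ h₂
    rw [fderiv_fun_sub h₁ h₂, sub_apply]
  rw [h.fderiv_eq, fderiv_fun_sub (hf.differentiableAt_fderiv_apply v)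
    (hg.differentiableAt_fderiv_apply v), sub_apply]

end DirectionalDerivatives

theorem lap_sub {f g : ℝ × ℝ → ℝ} {x : ℝ × ℝ} (hf : ContDiffAt ℝ 2 f x)
    (hg : ContDiffAt ℝ 2 g x) : lap (fun y => f y - g y) x = lap f x - lap g x := by
  have h₁ := fderiv_fderiv_apply_sub hf hg (1, 0)
  have h₂ := fderiv_fderiv_apply_sub hf hg (0, 1)
  unfold lap pd1 pd2
  linarith

theorem IsLocalMin.lap_nonneg {f : ℝ × ℝ → ℝ} {x : ℝ × ℝ} (hmin : IsLocalMin f x)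
    (hf : ContDiffAt ℝ 2 f x) : 0 ≤ lap f x :=
  add_nonneg (hmin.fderiv_fderiv_apply_nonneg hf _) (hmin.fderiv_fderiv_apply_nonneg hf _)

theorem pd1_eq_of_hasDerivAt {f : ℝ × ℝ → ℝ} {x : ℝ × ℝ} {a : ℝ} (hf : DifferentiableAt ℝ f x)
    (h : HasDerivAt (fun t => f (t, x.2)) a x.1) : pd1 f x = a := by
  have hl : HasDerivAt (fun t : ℝ => (t, x.2)) ((1 : ℝ), (0 : ℝ)) x.1 :=
    (hasDerivAt_id _).prodMk (hasDerivAt_const _ _)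
  exact (HasFDerivAt.comp_hasDerivAt x.1 (f := fun t : ℝ => (t, x.2)) hf.hasFDerivAt hl).unique h

theorem pd2_eq_of_hasDerivAt {f : ℝ × ℝ → ℝ} {x : ℝ × ℝ} {a : ℝ} (hf : DifferentiableAt ℝ f x)
    (h : HasDerivAt (fun t => f (x.1, t)) a x.2) : pd2 f x = a := by
  have hl : HasDerivAt (fun t : ℝ => (x.1, t)) ((0 : ℝ), (1 : ℝ)) x.2 :=
    (hasDerivAt_const _ _).prodMk (hasDerivAt_id _)
  exact (HasFDerivAt.comp_hasDerivAt x.2 (f := fun t : ℝ => (x.1, t)) hf.hasFDerivAt hl).unique h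

/-- The Laplacian can be computed by differentiating along coordinate lines. -/
theorem lap_eq_of_hasDerivAt {f f₁ f₂ : ℝ × ℝ → ℝ} {x : ℝ × ℝ} {a b : ℝ}
    (hf : ContDiffAt ℝ 2 f x)
    (h₁ : ∀ᶠ y : ℝ × ℝ in 𝓝 x, HasDerivAt (fun t => f (t, y.2)) (f₁ y) y.1)
    (h₂ : ∀ᶠ y : ℝ × ℝ in 𝓝 x, HasDerivAt (fun t => f (y.1, t)) (f₂ y) y.2)
    (h₁₁ : HasDerivAt (fun t => f₁ (t, x.2)) a x.1)
    (h₂₂ : HasDerivAt (fun t => f₂ (x.1, t)) b x.2) : lap f x = a + b := by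
  have e₁ : pd1 f =ᶠ[𝓝 x] f₁ := by
    filter_upwards [hf.eventually_differentiableAt, h₁] with y hy h using pd1_eq_of_hasDerivAt hy h
  have e₂ : pd2 f =ᶠ[𝓝 x] f₂ := by
    filter_upwards [hf.eventually_differentiableAt, h₂] with y hy h using pd2_eq_of_hasDerivAt hy h
  have d₁ : DifferentiableAt ℝ f₁ x :=
    (hf.differentiableAt_fderiv_apply (1, 0)).congr_of_eventuallyEq e₁.symm
  have d₂ : DifferentiableAt ℝ f₂ x :=
    (hf.differentiableAt_fderiv_apply (0, 1)).congr_of_eventuallyEq e₂.symm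
  have p₁ : pd1 (pd1 f) x = a := by
    rw [← pd1_eq_of_hasDerivAt d₁ h₁₁]
    unfold pd1 at e₁ ⊢
    rw [e₁.fderiv_eq]
  have p₂ : pd2 (pd2 f) x = b := by
    rw [← pd2_eq_of_hasDerivAt d₂ h₂₂]
    unfold pd2 at e₂ ⊢
    rw [e₂.fderiv_eq]
  rw [lap, p₁, p₂]

theorem lap_const (c : ℝ) (x : ℝ × ℝ) : lap (fun _ => c) x = 0 := by
  have h := lap_eq_of_hasDerivAt (f := fun _ => c) (f₁ := fun _ => 0) (f₂ := fun _ => 0) (x := x)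
    contDiffAt_const (.of_forall fun y => hasDerivAt_const _ _)
    (.of_forall fun y => hasDerivAt_const _ _) (hasDerivAt_const _ _) (hasDerivAt_const _ _)
  simpa using h

theorem lap_const_mul_normSq (ε : ℝ) (x : ℝ × ℝ) :
    lap (fun y => ε * (y.1 ^ 2 + y.2 ^ 2)) x = 4 * ε := by
  have h := lap_eq_of_hasDerivAt (f := fun y : ℝ × ℝ => ε * (y.1 ^ 2 + y.2 ^ 2))
    (f₁ := fun y => ε * (2 * y.1)) (f₂ := fun y => ε * (2 * y.2)) (x := x) (a := 2 * ε)
    (b := 2 * ε) (by fun_prop)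
    (.of_forall fun y => by
      simpa using ((hasDerivAt_pow 2 y.1).add_const (y.2 ^ 2)).const_mul ε)
    (.of_forall fun y => by
      simpa using ((hasDerivAt_pow 2 y.2).const_add (y.1 ^ 2)).const_mul ε)
    (by simpa [mul_comm] using ((hasDerivAt_id x.1).const_mul 2).const_mul ε)
    (by simpa [mul_comm] using ((hasDerivAt_id x.2).const_mul 2).const_mul ε)
  rw [h]
  ring

/-- Minimum principle for strictly superharmonic functions. -/
theorem le_of_lap_neg {U : Set (ℝ × ℝ)} {f : ℝ × ℝ → ℝ} {m : ℝ} (hU : IsOpen U)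
    (hb : Bornology.IsBounded U) (hc : ContinuousOn f (closure U)) (hf : ContDiffOn ℝ 2 f U)
    (hlap : ∀ x ∈ U, lap f x < 0) (hm : ∀ x ∈ frontier U, m ≤ f x) {x : ℝ × ℝ} (hx : x ∈ U) :
    m ≤ f x := by
  obtain ⟨y, hy, hmin⟩ := hb.isCompact_closure.exists_isMinOn ⟨x, subset_closure hx⟩ hc
  refine le_trans ?_ (hmin (subset_closure hx))
  by_cases hyU : y ∈ U
  · have hloc : IsLocalMin f y := (hmin.on_subset subset_closure).isLocalMin (hU.mem_nhds hyU)
    exact absurd (hloc.lap_nonneg (hf.contDiffAt (hU.mem_nhds hyU))) (hlap y hyU).not_ge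
  · exact hm y (hU.frontier_eq ▸ ⟨hy, hyU⟩)

/-- Comparison principle for the Laplacian on a bounded open set. -/
theorem le_of_lap_le {U : Set (ℝ × ℝ)} {u v : ℝ × ℝ → ℝ} (hU : IsOpen U)
    (hb : Bornology.IsBounded U) (hcu : ContinuousOn u (closure U))
    (hcv : ContinuousOn v (closure U)) (hu : ContDiffOn ℝ 2 u U) (hv : ContDiffOn ℝ 2 v U)
    (hlap : ∀ x ∈ U, lap v x ≤ lap u x) (hm : ∀ x ∈ frontier U, u x ≤ v x) {x : ℝ × ℝ}
    (hx : x ∈ U) : u x ≤ v x := by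
  obtain ⟨R, hR⟩ : ∃ R, ∀ y ∈ closure U, y.1 ^ 2 + y.2 ^ 2 ≤ R := by
    obtain ⟨R, hR⟩ := hb.isCompact_closure.bddAbove_image
      (f := fun y : ℝ × ℝ => y.1 ^ 2 + y.2 ^ 2) (by fun_prop)
    exact ⟨R, fun y hy => hR ⟨y, hy, rfl⟩⟩
  have key : ∀ ε > 0, u x ≤ v x + ε * R := by
    intro ε hε
    have hq : ContDiff ℝ 2 fun y : ℝ × ℝ => ε * (y.1 ^ 2 + y.2 ^ 2) := by fun_prop
    have h := le_of_lap_neg (f := fun y => (v y - u y) - ε * (y.1 ^ 2 + y.2 ^ 2)) (m := -(ε * R))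
      hU hb ((hcv.sub hcu).sub hq.continuous.continuousOn) ((hv.sub hu).sub hq.contDiffOn)
      (fun y hy => by
        have hu' := hu.contDiffAt (hU.mem_nhds hy)
        have hv' := hv.contDiffAt (hU.mem_nhds hy)
        rw [lap_sub (f := fun y => v y - u y) (hv'.sub hu') hq.contDiffAt, lap_sub hv' hu',
          lap_const_mul_normSq]
        linarith [hlap y hy])
      (fun y hy => by
        have h₁ := mul_le_mul_of_nonneg_left (hR y (frontier_subset_closure hy)) hε.le
        linarith [hm y hy]) hx
    have h₂ : 0 ≤ ε * (x.1 ^ 2 + x.2 ^ 2) := by positivity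
    linarith
  have hlim : Tendsto (fun ε : ℝ => v x + ε * R) (𝓝[>] 0) (𝓝 (v x)) := by
    have h : Continuous fun ε : ℝ => v x + ε * R := by fun_prop
    simpa using (h.tendsto 0).mono_left nhdsWithin_le_nhds
  exact ge_of_tendsto hlim (eventually_mem_nhdsWithin.mono key)

/-- Away from its pole `(1, 0)`, adding a multiple of the Poisson kernel
`(1 - |x|²) / |x - (1, 0)|² = 2 (1 - x₁) / |x - (1, 0)|² - 1` does not change the Laplacian. -/
theorem lap_affine_add_poissonKernel (β c : ℝ) {x : ℝ × ℝ} (hx : x.1 < 1) :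
    lap (fun y => (1 / 8) * (y.1 - 2 * β) * (1 - y.1 ^ 2 - y.2 ^ 2) +
      c * (2 * (1 - y.1) / ((1 - y.1) ^ 2 + y.2 ^ 2) - 1)) x = β - x.1 := by
  have hD : ∀ y : ℝ × ℝ, y.1 < 1 → (1 - y.1) ^ 2 + y.2 ^ 2 ≠ 0 := by
    intro y hy
    have : 0 < (1 - y.1) ^ 2 := pow_pos (by linarith) 2
    positivity
  have hev : ∀ᶠ y : ℝ × ℝ in 𝓝 x, y.1 < 1 :=
    (isOpen_lt continuous_fst continuous_const).mem_nhds hx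
  have hDx := hD x hx
  have s₁ : ∀ t : ℝ, HasDerivAt (fun t : ℝ => 1 - t) (-1) t := fun t => by
    simpa using (hasDerivAt_id t).const_sub 1
  have s₂ : ∀ t : ℝ, HasDerivAt (fun t : ℝ => t ^ 2) (2 * t) t := fun t => by
    simpa using hasDerivAt_pow 2 t
  have q₁ : ∀ a b : ℝ, HasDerivAt (fun t : ℝ => (1 - t) ^ 2 + b ^ 2) (-2 * (1 - a)) a :=
    fun a b => (((s₁ a).pow 2).add_const (b ^ 2)).congr_deriv (by norm_num)
  have q₂ : ∀ a b : ℝ, HasDerivAt (fun t : ℝ => (1 - a) ^ 2 + t ^ 2) (2 * b) b :=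
    fun a b => (s₂ b).const_add _
  have h := lap_eq_of_hasDerivAt
    (f := fun y : ℝ × ℝ => (1 / 8) * (y.1 - 2 * β) * (1 - y.1 ^ 2 - y.2 ^ 2) +
      c * (2 * (1 - y.1) / ((1 - y.1) ^ 2 + y.2 ^ 2) - 1))
    (f₁ := fun y => (1 / 8) * (1 - y.1 ^ 2 - y.2 ^ 2) - (1 / 8) * (y.1 - 2 * β) * (2 * y.1) +
      c * (2 * ((1 - y.1) ^ 2 - y.2 ^ 2) / ((1 - y.1) ^ 2 + y.2 ^ 2) ^ 2))
    (f₂ := fun y => - ((1 / 8) * (y.1 - 2 * β) * (2 * y.2)) +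
      c * (- (4 * (1 - y.1) * y.2) / ((1 - y.1) ^ 2 + y.2 ^ 2) ^ 2)) (x := x)
    (by
      refine ContDiffAt.add (by fun_prop) (contDiffAt_const.mul (ContDiffAt.sub ?_ (by fun_prop)))
      exact ContDiffAt.div (by fun_prop) (by fun_prop) hDx)
    (hev.mono fun y hy => by
      have hDy := hD y hy
      refine HasDerivAt.congr_deriv
        (((((hasDerivAt_id y.1).sub_const (2 * β)).const_mul (1 / 8)).mul
          (((s₂ y.1).const_sub 1).sub_const (y.2 ^ 2))).add
        (((((s₁ y.1).const_mul 2).div (q₁ y.1 y.2) hDy).sub_const 1).const_mul c)) ?_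
      simp only [id]
      field_simp
      ring)
    (hev.mono fun y hy => by
      have hDy := hD y hy
      refine HasDerivAt.congr_deriv
        ((((s₂ y.2).const_sub (1 - y.1 ^ 2)).const_mul (1 / 8 * (y.1 - 2 * β))).add
        ((((hasDerivAt_const y.2 (2 * (1 - y.1))).div (q₂ y.1 y.2) hDy).sub_const 1).const_mul
          c)) ?_
      field_simp
      ring)
    (HasDerivAt.add
      (((((s₂ x.1).const_sub 1).sub_const (x.2 ^ 2)).const_mul (1 / 8)).sub
        ((((hasDerivAt_id x.1).sub_const (2 * β)).const_mul (1 / 8)).mul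
          ((hasDerivAt_id x.1).const_mul 2)))
      ((((((s₁ x.1).pow 2).sub_const (x.2 ^ 2)).const_mul 2).div
        ((q₁ x.1 x.2).pow 2) (pow_ne_zero 2 hDx)).const_mul c))
    (HasDerivAt.add
      (((hasDerivAt_id x.2).const_mul 2).const_mul (1 / 8 * (x.1 - 2 * β))).neg
      (((((hasDerivAt_id x.2).const_mul (4 * (1 - x.1))).neg).div
        ((q₂ x.1 x.2).pow 2) (pow_ne_zero 2 hDx)).const_mul c))
  rw [h]
  simp only [id, Pi.pow_apply, Pi.neg_apply]
  field_simp
  ring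

/-- comparison of `ψ_β` and `ψ̂_β` for `1/2 < β < 1`: by the maximum
principle `ψ_β < ψ̂` in `Ω_β⁺`, so the oscillation of `ψ̂` over `Ω_β⁺` is strictly
smaller than that of `ψ_β` over the unit disc. -/
theorem affine_field_oscillation_comparison (β : ℝ) (hβ : 1 / 2 < β ∧ β < 1)
    (Ωβ : Set (ℝ × ℝ))
    (hΩβ : Ωβ = {x : ℝ × ℝ | x.1 ^ 2 + x.2 ^ 2 < 1 ∧ x.1 < β})
    (ψβ ψhat : ℝ × ℝ → ℝ)
    (hψdef : ψβ = fun x => (1 / 8) * (x.1 - 2 * β) * (1 - x.1 ^ 2 - x.2 ^ 2))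
    (hcont : ContinuousOn ψhat (closure Ωβ)) (hc2 : ContDiffOn ℝ 2 ψhat Ωβ)
    (hlap : ∀ x ∈ Ωβ, lap ψhat x = β - x.1)
    (hbdry : ∀ x ∈ frontier Ωβ, ψhat x = 0) :
    (∀ x ∈ Ωβ, ψβ x < ψhat x) ∧
    sSup (ψhat '' Ωβ) - sInf (ψhat '' Ωβ) < sSup (ψβ '' disc 1) - sInf (ψβ '' disc 1) := by
  obtain ⟨hβ₁, hβ₂⟩ := hβ
  have mem : ∀ x : ℝ × ℝ, x ∈ Ωβ ↔ x.1 ^ 2 + x.2 ^ 2 < 1 ∧ x.1 < β := fun x => by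
    rw [hΩβ]
    rfl
  have hopen : IsOpen Ωβ := by
    rw [hΩβ]
    have h₁ : IsOpen {x : ℝ × ℝ | x.1 ^ 2 + x.2 ^ 2 < 1} := isOpen_lt (by fun_prop) (by fun_prop)
    exact h₁.inter (isOpen_lt continuous_fst continuous_const)
  have hbdd : Bornology.IsBounded Ωβ := by
    refine (Metric.isBounded_closedBall (x := (0 : ℝ × ℝ)) (r := 1)).subset fun x hx => ?_
    have h := ((mem x).1 hx).1
    rw [mem_closedBall_zero_iff, Prod.norm_def, max_le_iff, Real.norm_eq_abs, Real.norm_eq_abs,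
      abs_le, abs_le]
    refine ⟨⟨?_, ?_⟩, ?_, ?_⟩ <;> nlinarith [sq_nonneg x.1, sq_nonneg x.2]
  have hcl : ∀ x ∈ closure Ωβ, x.1 ^ 2 + x.2 ^ 2 ≤ 1 ∧ x.1 ≤ β := by
    have hclosed : IsClosed {x : ℝ × ℝ | x.1 ^ 2 + x.2 ^ 2 ≤ 1 ∧ x.1 ≤ β} := by
      have h₁ : IsClosed {x : ℝ × ℝ | x.1 ^ 2 + x.2 ^ 2 ≤ 1} :=
        isClosed_le (by fun_prop) (by fun_prop)
      exact h₁.inter (isClosed_le continuous_fst continuous_const)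
    exact closure_minimal (fun x hx => ⟨((mem x).1 hx).1.le, ((mem x).1 hx).2.le⟩) hclosed
  have hfr : ∀ x ∈ frontier Ωβ, x.1 ^ 2 + x.2 ^ 2 = 1 ∨ x.1 = β := by
    intro x hx
    rw [hopen.frontier_eq] at hx
    obtain ⟨h₁, h₂⟩ := hcl x hx.1
    by_contra! hne
    exact hx.2 ((mem x).2 ⟨lt_of_le_of_ne h₁ hne.1, lt_of_le_of_ne h₂ hne.2⟩)
  have hD : ∀ x : ℝ × ℝ, x.1 ≤ β → (1 - β) ^ 2 ≤ (1 - x.1) ^ 2 + x.2 ^ 2 := fun x hx => by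
    nlinarith [sq_nonneg x.2]
  have hβ0 : 0 < (1 - β) ^ 2 := pow_pos (by linarith) 2
  have hpoisson : ∀ x : ℝ × ℝ, x.1 ≤ β → 2 * (1 - x.1) / ((1 - x.1) ^ 2 + x.2 ^ 2) - 1 =
      (1 - x.1 ^ 2 - x.2 ^ 2) / ((1 - x.1) ^ 2 + x.2 ^ 2) := fun x hx => by
    have : (1 - x.1) ^ 2 + x.2 ^ 2 ≠ 0 := (hβ0.trans_le (hD x hx)).ne'
    field_simp
    ring
  set c : ℝ := β * (1 - β) ^ 2 / 8 with hc
  have hcpos : 0 < c := by positivity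
  set v : ℝ × ℝ → ℝ := fun y => (1 / 8) * (y.1 - 2 * β) * (1 - y.1 ^ 2 - y.2 ^ 2) +
      c * (2 * (1 - y.1) / ((1 - y.1) ^ 2 + y.2 ^ 2) - 1) with hv
  have hvsmooth : ∀ x : ℝ × ℝ, x.1 ≤ β → ContDiffAt ℝ 2 v x := fun x hx => by
    refine ContDiffAt.add (by fun_prop) (contDiffAt_const.mul (ContDiffAt.sub ?_ (by fun_prop)))
    exact ContDiffAt.div (by fun_prop) (by fun_prop) (hβ0.trans_le (hD x hx)).ne'
  have hlower : ∀ x ∈ Ωβ, v x ≤ ψhat x := by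
    intro x hx
    refine le_of_lap_le hopen hbdd
      (fun y hy => (hvsmooth y (hcl y hy).2).continuousAt.continuousWithinAt) hcont
      (fun y hy => (hvsmooth y ((mem y).1 hy).2.le).contDiffWithinAt) hc2 (fun y hy => ?_)
      (fun y hy => ?_) hx
    · rw [hlap y hy, lap_affine_add_poissonKernel β c (((mem y).1 hy).2.trans hβ₂)]
    · obtain ⟨h₁, h₂⟩ := hcl y (frontier_subset_closure hy)
      rw [hbdry y hy, hv]
      beta_reduce
      rw [hpoisson y h₂]
      rcases hfr y hy with h | h
      · have : 1 - y.1 ^ 2 - y.2 ^ 2 = 0 := by linarith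
        simp [this]
      · have hs : 0 ≤ 1 - y.1 ^ 2 - y.2 ^ 2 := by linarith
        have hle : (1 - y.1 ^ 2 - y.2 ^ 2) / ((1 - y.1) ^ 2 + y.2 ^ 2) ≤
            (1 - y.1 ^ 2 - y.2 ^ 2) / (1 - β) ^ 2 :=
          div_le_div_of_nonneg_left hs hβ0 (hD y h₂)
        have hmul := mul_le_mul_of_nonneg_left hle hcpos.le
        have heq : c * ((1 - y.1 ^ 2 - y.2 ^ 2) / (1 - β) ^ 2) =
            β / 8 * (1 - y.1 ^ 2 - y.2 ^ 2) := by
          have hne : 1 - β ≠ 0 := by linarith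
          rw [hc]
          field_simp
        rw [heq] at hmul
        calc _ ≤ 1 / 8 * (y.1 - 2 * β) * (1 - y.1 ^ 2 - y.2 ^ 2) +
              β / 8 * (1 - y.1 ^ 2 - y.2 ^ 2) := by gcongr
          _ = 0 := by
            rw [h]
            ring
  have hstrict : ∀ x ∈ Ωβ, ψβ x < ψhat x := by
    intro x hx
    obtain ⟨h₁, h₂⟩ := (mem x).1 hx
    refine lt_of_lt_of_le ?_ (hlower x hx)
    rw [hψdef, hv]
    beta_reduce
    rw [hpoisson x h₂.le]
    have : 0 < c * ((1 - x.1 ^ 2 - x.2 ^ 2) / ((1 - x.1) ^ 2 + x.2 ^ 2)) :=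
      mul_pos hcpos (div_pos (by linarith) (hβ0.trans_le (hD x h₂.le)))
    linarith
  have hnonpos : ∀ x ∈ Ωβ, ψhat x ≤ 0 := by
    intro x hx
    refine le_of_lap_le hopen hbdd hcont (v := fun _ => 0) continuousOn_const hc2
      contDiffOn_const (fun y hy => ?_) (fun y hy => (hbdry y hy).le) hx
    rw [lap_const, hlap y hy]
    linarith [((mem y).1 hy).2]
  have hzero : (0 : ℝ × ℝ) ∈ Ωβ := (mem 0).2 ⟨by simp, by simpa using by linarith⟩
  have hsub : Ωβ ⊆ disc 1 := fun x hx => by simpa [disc] using ((mem x).1 hx).1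
  have hbounds : ∀ x ∈ disc 1, -(3 / 8) ≤ ψβ x ∧ ψβ x ≤ 0 := by
    intro x hx
    have h : x.1 ^ 2 + x.2 ^ 2 < 1 := by simpa [disc] using hx
    have h₁ : -1 < x.1 := by nlinarith [sq_nonneg x.1, sq_nonneg x.2]
    have h₂ : x.1 < 1 := by nlinarith [sq_nonneg x.1, sq_nonneg x.2]
    rw [hψdef]
    beta_reduce
    constructor <;> nlinarith [sq_nonneg x.1, sq_nonneg x.2]
  have hbelow : BddBelow (ψβ '' disc 1) := ⟨-(3 / 8), by
    rintro _ ⟨x, hx, rfl⟩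
    exact (hbounds x hx).1⟩
  have habove : BddAbove (ψβ '' disc 1) := ⟨0, by
    rintro _ ⟨x, hx, rfl⟩
    exact (hbounds x hx).2⟩
  have hsup : 0 ≤ sSup (ψβ '' disc 1) := by
    have hψ : Continuous ψβ := by
      rw [hψdef]
      fun_prop
    have hlim : Tendsto (fun t : ℝ => ψβ (t, 0)) (𝓝[<] 1) (𝓝 0) := by
      have h : Continuous fun t : ℝ => ψβ (t, 0) := by fun_prop
      simpa [hψdef] using (h.tendsto 1).mono_left nhdsWithin_le_nhds
    refine le_of_tendsto hlim ?_
    filter_upwards [Ioo_mem_nhdsLT (show (0 : ℝ) < 1 by norm_num)] with t ht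
    refine le_csSup habove ⟨(t, 0), ?_, rfl⟩
    have : t ^ 2 < 1 := by nlinarith [ht.1, ht.2]
    simpa [disc] using this
  have hsuphat : sSup (ψhat '' Ωβ) ≤ 0 :=
    csSup_le ⟨_, 0, hzero, rfl⟩ (by
      rintro _ ⟨x, hx, rfl⟩
      exact hnonpos x hx)
  have hinf : sInf (ψβ '' disc 1) < sInf (ψhat '' Ωβ) := by
    obtain ⟨y, hy, hmin⟩ := hbdd.isCompact_closure.exists_isMinOn ⟨0, subset_closure hzero⟩ hcont
    have hle : ψhat y ≤ sInf (ψhat '' Ωβ) := le_csInf ⟨_, 0, hzero, rfl⟩ (by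
      rintro _ ⟨x, hx, rfl⟩
      exact hmin (subset_closure hx))
    refine lt_of_lt_of_le ?_ hle
    by_cases hyΩ : y ∈ Ωβ
    · exact (csInf_le hbelow ⟨y, hsub hyΩ, rfl⟩).trans_lt (hstrict y hyΩ)
    · rw [hbdry y (hopen.frontier_eq ▸ ⟨hy, hyΩ⟩)]
      exact (csInf_le hbelow ⟨0, hsub hzero, rfl⟩).trans_lt
        ((hstrict 0 hzero).trans_le (hnonpos 0 hzero))
  exact ⟨hstrict, by linarith⟩
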